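/- Let m = m₁ + m₂ with m₁, m₂ ≥ 1, and let Q be the subgroup of W^B_m generated by s₀, s₁, …, s_{m₁−1}, the element s_{m₁}⋯s₁s₀s₁⋯s_{m₁}, and s_{m₁+1}, …, s_{m₁+m₂−1}. Then there is a group isomorphism W^B_{m₁} × W^B_{m₂} ≅ Q, given by sending (s_i, 1) ↦ s_i for 0 ≤ i ≤ m₁−1, (1, s_j) ↦ s_{j+m₁} for 1 ≤ j ≤ m₂−1, and (1, s₀) ↦ s_{m₁}⋯s₁s₀s₁⋯s_{m₁}. -/

import Mathlib

noncomputable section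

namespace VVPaper

/-- The defining relators for the Coxeter group `W^B_m` of type `B_m` on generators
`s₀, s₁, …, s_{m-1}`: `s_i² = 1`, `(s_i s_j)² = 1` for `|i - j| ≥ 2`, `(s_i s_{i+1})³ = 1`
for `1 ≤ i ≤ m - 2`, and `(s₀ s₁)⁴ = 1`. -/
def typeBRels (m : ℕ) : Set (FreeGroup (Fin m)) :=
  {r | (∃ i : Fin m, r = FreeGroup.of i ^ 2) ∨
    (∃ i j : Fin m, (i : ℕ) + 2 ≤ (j : ℕ) ∧ r = (FreeGroup.of i * FreeGroup.of j) ^ 2) ∨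
    (∃ i j : Fin m, 1 ≤ (i : ℕ) ∧ (j : ℕ) = (i : ℕ) + 1 ∧
      r = (FreeGroup.of i * FreeGroup.of j) ^ 3) ∨
    (∃ i j : Fin m, (i : ℕ) = 0 ∧ (j : ℕ) = 1 ∧
      r = (FreeGroup.of i * FreeGroup.of j) ^ 4)}

/-- The Coxeter group `W^B_m` of type `B_m`. -/
abbrev WB (m : ℕ) : Type := PresentedGroup (typeBRels m)

/-- The generator `s_n` of `W^B_m` (defined to be `1` for out-of-range indices). -/
def s (m n : ℕ) : WB m :=
  if h : n < m then PresentedGroup.of ⟨n, h⟩ else 1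

/-- The element `s_j ⋯ s₁ s₀ s₁ ⋯ s_j` of `W^B_m`. -/
def tElt (m : ℕ) : ℕ → WB m
  | 0 => s m 0
  | j + 1 => s m (j + 1) * tElt m j * s m (j + 1)

/-- The quasi-parabolic subgroup
`Q = ⟨s₀, …, s_{m₁-1}, s_{m₁} ⋯ s₁ s₀ s₁ ⋯ s_{m₁}, s_{m₁+1}, …, s_{m₁+m₂-1}⟩ ⊆ W^B_{m₁+m₂}`. -/
def Q (m₁ m₂ : ℕ) : Subgroup (WB (m₁ + m₂)) :=
  Subgroup.closure
    ({x | ∃ i : ℕ, i < m₁ ∧ x = s (m₁ + m₂) i} ∪ {tElt (m₁ + m₂) m₁} ∪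
      {x | ∃ j : ℕ, m₁ + 1 ≤ j ∧ j < m₁ + m₂ ∧ x = s (m₁ + m₂) j})

/-- A sequence in a group whose first `m` terms satisfy the type `B_m` Coxeter relations. -/
structure TypeBSystem {G : Type*} [Group G] (m : ℕ) (g : ℕ → G) : Prop where
  sq : ∀ i, i < m → g i * g i = 1
  comm : ∀ i j, i + 2 ≤ j → j < m → g i * g j = g j * g i
  braid : ∀ i, 1 ≤ i → i + 1 < m → g i * g (i + 1) * g i = g (i + 1) * g i * g (i + 1)
  braid_four : 1 < m → g 0 * g 1 * g 0 * g 1 = g 1 * g 0 * g 1 * g 0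

theorem s_eq_of {m i : ℕ} (h : i < m) : s m i = PresentedGroup.of ⟨i, h⟩ := dif_pos h

theorem mk_eq_one_of_mem {m : ℕ} {r : FreeGroup (Fin m)} (h : r ∈ typeBRels m) :
    PresentedGroup.mk (typeBRels m) r = 1 :=
  PresentedGroup.one_of_mem h

theorem typeBSystem_s (m : ℕ) : TypeBSystem m (s m) := by
  have sq : ∀ i, i < m → s m i * s m i = 1 := by
    intro i hi
    have := mk_eq_one_of_mem (m := m) (Or.inl ⟨⟨i, hi⟩, rfl⟩)
    rw [s_eq_of hi, ← sq]
    simpa [PresentedGroup.of] using this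
  have inv : ∀ i, i < m → (s m i)⁻¹ = s m i := fun i hi => inv_eq_of_mul_eq_one_left (sq i hi)
  refine ⟨sq, ?_, ?_, ?_⟩
  · intro i j hij hj
    have hi : i < m := by omega
    have := mk_eq_one_of_mem (m := m) (Or.inr (Or.inl ⟨⟨i, hi⟩, ⟨j, hj⟩, hij, rfl⟩))
    have h2 : (s m i * s m j) ^ 2 = 1 := by
      rw [s_eq_of hi, s_eq_of hj]
      simpa [PresentedGroup.of] using this
    rw [pow_two] at h2
    have := eq_inv_of_mul_eq_one_left h2
    rwa [mul_inv_rev, inv i hi, inv j hj] at this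
  · intro i h1 hj
    have hi : i < m := by omega
    have := mk_eq_one_of_mem (m := m)
      (Or.inr (Or.inr (Or.inl ⟨⟨i, hi⟩, ⟨i + 1, hj⟩, h1, rfl, rfl⟩)))
    have h2 : (s m i * s m (i + 1)) ^ 3 = 1 := by
      rw [s_eq_of hi, s_eq_of hj]
      simpa [PresentedGroup.of] using this
    have h3 : s m i * s m (i + 1) * s m i * (s m (i + 1) * s m i * s m (i + 1)) = 1 := by
      rw [← h2]; simp only [pow_succ, pow_zero, one_mul, mul_assoc]
    have := eq_inv_of_mul_eq_one_left h3
    rwa [mul_inv_rev, mul_inv_rev, inv i hi, inv _ hj, ← mul_assoc] at this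
  · intro hj
    have hi : 0 < m := by omega
    have := mk_eq_one_of_mem (m := m)
      (Or.inr (Or.inr (Or.inr ⟨⟨0, hi⟩, ⟨1, hj⟩, rfl, rfl, rfl⟩)))
    have h2 : (s m 0 * s m 1) ^ 4 = 1 := by
      rw [s_eq_of hi, s_eq_of hj]
      simpa [PresentedGroup.of] using this
    have h3 : s m 0 * s m 1 * s m 0 * s m 1 * (s m 0 * s m 1 * s m 0 * s m 1) = 1 := by
      rw [← h2]; simp only [pow_succ, pow_zero, one_mul, mul_assoc]
    have := eq_inv_of_mul_eq_one_left h3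
    rwa [mul_inv_rev, mul_inv_rev, mul_inv_rev, inv 0 hi, inv _ hj, ← mul_assoc,
      ← mul_assoc] at this

@[elab_as_elim]
theorem WB.induction_left {m : ℕ} {P : WB m → Prop} (one : P 1)
    (mul : ∀ i, i < m → ∀ w, P w → P (s m i * w)) (w : WB m) : P w := by
  have hw : w ∈ Subgroup.closure (Set.range (PresentedGroup.of (rels := typeBRels m))) := by
    rw [PresentedGroup.closure_range_of]; trivial
  induction hw using Subgroup.closure_induction_left with
  | one => exact one
  | mul_left x hx y _ ih =>
    obtain ⟨i, rfl⟩ := hx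
    simpa [s_eq_of i.2] using mul i i.2 y ih
  | inv_mul_cancel x hx y _ ih =>
    obtain ⟨i, rfl⟩ := hx
    have h := inv_eq_of_mul_eq_one_left ((typeBSystem_s m).sq i i.2)
    rw [s_eq_of i.2] at h
    rw [Fin.eta] at h
    rw [h]
    simpa [s_eq_of i.2] using mul i i.2 y ih

namespace TypeBSystem

section Group

variable {G : Type*} [Group G] {m : ℕ} {g : ℕ → G}

theorem mono (hg : TypeBSystem m g) {n : ℕ} (h : n ≤ m) : TypeBSystem n g :=
  ⟨fun i hi => hg.sq i (by omega), fun i j hij hj => hg.comm i j hij (by omega),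
    fun i h1 hi => hg.braid i h1 (by omega), fun h1 => hg.braid_four (by omega)⟩

theorem lift_eq_one_of_mem (hg : TypeBSystem m g) :
    ∀ r ∈ typeBRels m, FreeGroup.lift (fun i : Fin m => g i) r = 1 := by
  rintro r (⟨i, rfl⟩ | ⟨i, j, hij, rfl⟩ | ⟨i, j, hi, hj, rfl⟩ | ⟨i, j, hi, hj, rfl⟩)
  · simpa [pow_two] using hg.sq i i.2
  · have h := hg.comm i j hij j.2
    have hi := hg.sq i i.2
    have hj := hg.sq j j.2
    simp only [map_pow, map_mul, FreeGroup.lift_apply_of]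
    calc (g i * g j) ^ 2 = g i * g j * (g i * g j) := pow_two _
      _ = g i * g j * (g j * g i) := by rw [h]
      _ = g i * (g j * g j) * g i := by group
      _ = 1 := by rw [hj, mul_one, hi]
  · have h := hg.braid i hi (by omega)
    rw [← hj] at h
    have hi := hg.sq i i.2
    have hj := hg.sq j j.2
    simp only [map_pow, map_mul, FreeGroup.lift_apply_of]
    calc (g i * g j) ^ 3 = (g i * g j * g i) * (g j * g i * g j) := by
          simp only [pow_succ, pow_zero, one_mul, mul_assoc]
      _ = (g i * g j * g i) * (g i * g j * g i) := by rw [h]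
      _ = g i * g j * (g i * g i) * g j * g i := by group
      _ = g i * (g j * g j) * g i := by rw [hi]; group
      _ = 1 := by rw [hj, mul_one, hi]
  · have h := hg.braid_four (by omega)
    rw [← hi, ← hj] at h
    have hi := hg.sq i i.2
    have hj := hg.sq j j.2
    simp only [map_pow, map_mul, FreeGroup.lift_apply_of]
    calc (g i * g j) ^ 4 = (g i * g j * g i * g j) * (g i * g j * g i * g j) := by
          simp only [pow_succ, pow_zero, one_mul, mul_assoc]
      _ = (g i * g j * g i * g j) * (g j * g i * g j * g i) := by rw [h]
      _ = g i * g j * g i * (g j * g j) * g i * g j * g i := by group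
      _ = g i * g j * (g i * g i) * g j * g i := by rw [hj]; group
      _ = g i * (g j * g j) * g i := by rw [hi]; group
      _ = 1 := by rw [hj, mul_one, hi]

/-- The homomorphism `W^B_m → G` determined by a system of type `B_m` in `G`. -/
def lift (hg : TypeBSystem m g) : WB m →* G :=
  PresentedGroup.toGroup hg.lift_eq_one_of_mem

theorem lift_s (hg : TypeBSystem m g) {i : ℕ} (hi : i < m) : hg.lift (s m i) = g i := by
  rw [s_eq_of hi]
  exact PresentedGroup.toGroup.of hg.lift_eq_one_of_mem

end Group

end TypeBSystem

/-- The sign change and adjacent transpositions on `ℤ`, where `-1 - p` is the negative of `p`. -/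
def flipFun (i : ℕ) (p : ℤ) : ℤ :=
  if p = i - 1 then i else if p = i then i - 1 else
    if p = -i - 1 then -i else if p = -i then -i - 1 else p

theorem flipFun_involutive (i : ℕ) : Function.Involutive (flipFun i) := by
  intro p
  unfold flipFun
  grind

/-- The signed permutation of `ℤ` representing the generator `s_i`. -/
def flip (i : ℕ) : Equiv.Perm ℤ := (flipFun_involutive i).toPerm

theorem flip_apply (i : ℕ) (p : ℤ) : flip i p =
    if p = i - 1 then (i : ℤ) else if p = i then (i : ℤ) - 1 else
      if p = -i - 1 then -(i : ℤ) else if p = -i then -(i : ℤ) - 1 else p := rfl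

theorem flip_cases (i : ℕ) (p : ℤ) :
    (p = i - 1 ∧ flip i p = i) ∨ (p = i ∧ flip i p = i - 1) ∨
      (p = -i - 1 ∧ flip i p = -i) ∨ (p = -i ∧ flip i p = -i - 1) ∨
      (p ≠ i - 1 ∧ p ≠ i ∧ p ≠ -i - 1 ∧ p ≠ -i ∧ flip i p = p) := by
  rw [flip_apply]
  split_ifs <;> omega

theorem typeBSystem_flip (m : ℕ) : TypeBSystem m flip := by
  refine ⟨?_, ?_, ?_, ?_⟩
  · intro i _
    ext p
    exact flipFun_involutive i p
  · intro i j hij _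
    ext p
    simp only [Equiv.Perm.mul_apply]
    have h1 := flip_cases j p
    have h2 := flip_cases i p
    have h3 := flip_cases i (flip j p)
    have h4 := flip_cases j (flip i p)
    omega
  · intro i hi _
    ext p
    simp only [Equiv.Perm.mul_apply]
    have h1 := flip_cases i p
    have h2 := flip_cases (i + 1) (flip i p)
    have h3 := flip_cases i (flip (i + 1) (flip i p))
    have h4 := flip_cases (i + 1) p
    have h5 := flip_cases i (flip (i + 1) p)
    have h6 := flip_cases (i + 1) (flip i (flip (i + 1) p))
    push_cast at *
    rcases h1 with h1 | h1 | h1 | h1 | h1 <;> rcases h4 with h4 | h4 | h4 | h4 | h4 <;> omega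
  · intro _
    ext p
    simp only [Equiv.Perm.mul_apply]
    have h1 := flip_cases 1 p
    have h2 := flip_cases 0 (flip 1 p)
    have h3 := flip_cases 1 (flip 0 (flip 1 p))
    have h4 := flip_cases 0 (flip 1 (flip 0 (flip 1 p)))
    have h5 := flip_cases 0 p
    have h6 := flip_cases 1 (flip 0 p)
    have h7 := flip_cases 0 (flip 1 (flip 0 p))
    have h8 := flip_cases 1 (flip 0 (flip 1 (flip 0 p)))
    push_cast at *
    rcases h1 with h1 | h1 | h1 | h1 | h1 <;> rcases h5 with h5 | h5 | h5 | h5 | h5 <;> omega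


/-! ### The elements `s_k ⋯ s₁ s₀ s₁ ⋯ s_k` -/

theorem s_mul_s {m i : ℕ} (hi : i < m) : s m i * s m i = 1 := (typeBSystem_s m).sq i hi

theorem s_mul_s_mul {m i : ℕ} (hi : i < m) (w : WB m) : s m i * (s m i * w) = w := by
  rw [← mul_assoc, s_mul_s hi, one_mul]

theorem commute_s {m i j : ℕ} (hij : i + 2 ≤ j) (hj : j < m) : Commute (s m i) (s m j) :=
  (typeBSystem_s m).comm i j hij hj

theorem tElt_succ (m k : ℕ) : tElt m (k + 1) = s m (k + 1) * tElt m k * s m (k + 1) := rfl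

theorem tElt_mul_tElt {m k : ℕ} (hk : k < m) : tElt m k * tElt m k = 1 := by
  induction k with
  | zero => exact s_mul_s hk
  | succ k ih =>
    rw [tElt_succ]
    simp only [mul_assoc]
    rw [s_mul_s_mul hk, ← mul_assoc (tElt m k), ih (by omega), one_mul, s_mul_s hk]

theorem commute_tElt_of_gt {m k i : ℕ} (hk : k + 1 < i) (hi : i < m) :
    Commute (s m i) (tElt m k) := by
  induction k with
  | zero => exact (commute_s (by omega) hi).symm
  | succ k ih =>
    have h := (commute_s (i := k + 1) (j := i) (by omega) hi).symm
    exact (h.mul_right (ih (by omega))).mul_right h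

theorem commute_tElt_of_lt {m k i : ℕ} (hi : i < k) (hk : k < m) :
    Commute (s m i) (tElt m k) := by
  induction k with
  | zero => omega
  | succ k ih =>
    rcases Nat.lt_or_ge i k with h | h
    · have hc := commute_s (i := i) (j := k + 1) (by omega) hk
      exact (hc.mul_right (ih h (by omega))).mul_right hc
    · obtain rfl : i = k := by omega
      cases i with
      | zero =>
        have h := (typeBSystem_s m).braid_four hk
        simp only [Commute, SemiconjBy, tElt, zero_add, ← mul_assoc]
        exact h
      | succ k =>
        have hb := (typeBSystem_s m).braid (k + 1) (by omega) hk
        have hc : Commute (s m (k + 2)) (tElt m k) := commute_tElt_of_gt (by omega) hk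
        set a := s m (k + 1)
        set b := s m (k + 2)
        set t := tElt m k
        change a * (b * (a * t * a) * b) = b * (a * t * a) * b * a
        calc a * (b * (a * t * a) * b) = (a * b * a) * t * a * b := by simp only [mul_assoc]
          _ = b * a * (b * t) * a * b := by rw [hb]; simp only [mul_assoc]
          _ = b * a * t * (b * a * b) := by rw [hc.eq]; simp only [mul_assoc]
          _ = b * (a * t * a) * b * a := by rw [← hb]; simp only [mul_assoc]

theorem commute_tElt_succ {m k : ℕ} (hk : k + 1 < m) :
    Commute (tElt m k) (tElt m (k + 1)) := by
  have h : ∀ j, j ≤ k → Commute (tElt m j) (tElt m (k + 1)) := by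
    intro j hj
    induction j with
    | zero => exact commute_tElt_of_lt (by omega) hk
    | succ j ih =>
      have hc : Commute (s m (j + 1)) (tElt m (k + 1)) := commute_tElt_of_lt (by omega) hk
      exact (hc.mul_left (ih (by omega))).mul_left hc
  exact h k le_rfl

/-! ### Coset representatives of `W^B_m` in `W^B_{m+1}` -/

/-- The natural homomorphism `W^B_n → W^B_m` for `n ≤ m`. -/
def incl {n m : ℕ} (h : n ≤ m) : WB n →* WB m := ((typeBSystem_s m).mono h).lift

theorem incl_s {n m i : ℕ} (h : n ≤ m) (hi : i < n) : incl h (s n i) = s m i :=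
  TypeBSystem.lift_s _ hi

/-- The element `s_{m-j+1} ⋯ s_m` of `W^B_{m+1}`. -/
def cosetRep (m : ℕ) : ℕ → WB (m + 1)
  | 0 => 1
  | j + 1 => s (m + 1) (m - j) * cosetRep m j

theorem cosetRep_succ (m j : ℕ) :
    cosetRep m (j + 1) = s (m + 1) (m - j) * cosetRep m j := rfl

theorem commute_cosetRep {m i j : ℕ} (h : i + j < m) :
    Commute (s (m + 1) i) (cosetRep m j) := by
  induction j with
  | zero => exact Commute.one_right _
  | succ j ih => exact (commute_s (by omega) (by omega)).mul_right (ih (by omega))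

theorem s_succ_mul_cosetRep {m i j : ℕ} (hi : i < m) (hj : j ≤ m) (h : m < i + j) :
    s (m + 1) (i + 1) * cosetRep m j = cosetRep m j * s (m + 1) i := by
  induction j with
  | zero => omega
  | succ j ih =>
    rcases Nat.lt_or_ge m (i + j) with h' | h'
    · have hc := commute_s (m := m + 1) (i := m - j) (j := i + 1) (by omega) (by omega)
      rw [cosetRep_succ, ← mul_assoc, ← hc.eq, mul_assoc, ih (by omega) h', mul_assoc]
    · obtain ⟨k, rfl⟩ : ∃ k, j = k + 1 := ⟨j - 1, by omega⟩
      have hb := (typeBSystem_s (m + 1)).braid i (by omega) (by omega)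
      have hc : Commute (s (m + 1) i) (cosetRep m k) := commute_cosetRep (by omega)
      rw [cosetRep_succ, cosetRep_succ, show m - (k + 1) = i by omega,
        show m - k = i + 1 by omega, ← mul_assoc, ← mul_assoc, ← hb]
      simp only [mul_assoc]
      rw [hc.eq]

theorem cosetRep_mul_tElt {m j : ℕ} (hj : j ≤ m) :
    cosetRep m j * tElt (m + 1) m = tElt (m + 1) (m - j) * cosetRep m j := by
  induction j with
  | zero => simp [cosetRep]
  | succ j ih =>
    have hm : m - j = m - (j + 1) + 1 := by omega
    rw [cosetRep_succ, mul_assoc, ih (by omega), hm, tElt_succ]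
    simp only [mul_assoc]
    rw [s_mul_s_mul (by omega)]

theorem exists_s_mul_cosetRep {m i j : ℕ} (h1 : 1 ≤ i) (hi : i ≤ m) (hj : j ≤ m) :
    ∃ j' ≤ m, ∃ h : WB m,
      s (m + 1) i * cosetRep m j = cosetRep m j' * incl m.le_succ h := by
  rcases lt_trichotomy (i + j) m with h | h | h
  · exact ⟨j, hj, s m i, by rw [incl_s _ (by omega), (commute_cosetRep h).eq]⟩
  · refine ⟨j + 1, by omega, 1, ?_⟩
    rw [map_one, mul_one, cosetRep_succ, show m - j = i by omega]
  · obtain ⟨i, rfl⟩ : ∃ k, i = k + 1 := ⟨i - 1, by omega⟩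
    rcases Nat.lt_or_ge m (i + j) with h' | h'
    · exact ⟨j, hj, s m i, by rw [incl_s _ (by omega), s_succ_mul_cosetRep hi hj h']⟩
    · obtain ⟨j, rfl⟩ : ∃ k, j = k + 1 := ⟨j - 1, by omega⟩
      refine ⟨j, by omega, 1, ?_⟩
      rw [map_one, mul_one, cosetRep_succ, show m - j = i + 1 by omega,
        s_mul_s_mul (by omega)]

theorem commute_incl_tElt {n m k : ℕ} (h : n ≤ m) (hn : n ≤ k) (hk : k < m) (w : WB n) :
    Commute (incl h w) (tElt m k) := by
  induction w using WB.induction_left with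
  | one => rw [map_one]; exact Commute.one_left _
  | mul i hi w ih =>
    rw [map_mul, incl_s _ hi]
    exact (commute_tElt_of_lt (by omega) hk).mul_left ih

theorem exists_eq_cosetRep_mul {m : ℕ} (w : WB (m + 1)) :
    ∃ j ≤ m, ∃ h : WB m, w = cosetRep m j * incl m.le_succ h ∨
      w = cosetRep m j * tElt (m + 1) m * incl m.le_succ h := by
  induction w using WB.induction_left with
  | one => exact ⟨0, by omega, 1, Or.inl (by simp [cosetRep])⟩
  | mul i hi w ih =>
    obtain ⟨j, hj, h, hw⟩ := ih
    rcases Nat.eq_zero_or_pos i with rfl | h1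
    · rcases Nat.lt_or_ge j m with hjm | hjm
      · have hc : Commute (s (m + 1) 0) (cosetRep m j) := commute_cosetRep (by omega)
        have ht : Commute (s (m + 1) 0) (tElt (m + 1) m) :=
          commute_tElt_of_lt (by omega) (by omega)
        refine ⟨j, hj, s m 0 * h, ?_⟩
        rw [map_mul, incl_s _ (by omega)]
        refine hw.imp ?_ ?_ <;> rintro rfl
        · rw [← mul_assoc, hc.eq, mul_assoc]
        · rw [← mul_assoc, (hc.mul_right ht).eq, mul_assoc]
      · obtain rfl : j = m := by omega
        have hc := cosetRep_mul_tElt (le_refl j)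
        rw [Nat.sub_self] at hc
        change _ = s (j + 1) 0 * _ at hc
        refine ⟨j, hj, h, ?_⟩
        rcases hw with rfl | rfl
        · exact Or.inr (by rw [hc, mul_assoc])
        · exact Or.inl (by rw [hc, mul_assoc, s_mul_s_mul (by omega)])
    · obtain ⟨j', hj', h', e⟩ := exists_s_mul_cosetRep h1 (by omega : i ≤ m) hj
      refine ⟨j', hj', h' * h, ?_⟩
      rw [map_mul]
      refine hw.imp ?_ ?_ <;> rintro rfl
      · rw [← mul_assoc, e, mul_assoc]
      · rw [← mul_assoc, ← mul_assoc, e, mul_assoc (cosetRep m j'),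
          (commute_incl_tElt m.le_succ le_rfl (by omega) h').eq]
        simp only [mul_assoc]

/-! ### Faithfulness of the signed permutation representation -/

/-- The representation of `W^B_m` by signed permutations. -/
def signedPerm (m : ℕ) : WB m →* Equiv.Perm ℤ := (typeBSystem_flip m).lift

theorem signedPerm_s {m i : ℕ} (hi : i < m) : signedPerm m (s m i) = flip i :=
  TypeBSystem.lift_s _ hi

theorem signedPerm_incl {n m : ℕ} (h : n ≤ m) (w : WB n) :
    signedPerm m (incl h w) = signedPerm n w := by
  induction w using WB.induction_left with
  | one => simp
  | mul i hi w ih =>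
    rw [map_mul, map_mul, map_mul, ih, incl_s h hi, signedPerm_s hi, signedPerm_s (by omega)]

theorem signedPerm_apply_of_ge {m : ℕ} (w : WB m) {p : ℤ} (hp : m ≤ p ∨ p < -m) :
    signedPerm m w p = p := by
  induction w using WB.induction_left with
  | one => simp
  | mul i hi w ih =>
    rw [map_mul, signedPerm_s hi, Equiv.Perm.mul_apply, ih]
    have := flip_cases i p
    omega

theorem signedPerm_tElt_cases {m k : ℕ} (hk : k < m) (p : ℤ) :
    (p = k ∧ signedPerm m (tElt m k) p = -k - 1) ∨
      (p = -k - 1 ∧ signedPerm m (tElt m k) p = k) ∨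
      (p ≠ k ∧ p ≠ -k - 1 ∧ signedPerm m (tElt m k) p = p) := by
  induction k generalizing p with
  | zero =>
    change (_ ∧ signedPerm m (s m 0) p = _) ∨ (_ ∧ signedPerm m (s m 0) p = _) ∨
      (_ ∧ _ ∧ signedPerm m (s m 0) p = _)
    rw [signedPerm_s hk]
    have := flip_cases 0 p
    push_cast at *
    omega
  | succ k ih =>
    rw [tElt_succ, map_mul, map_mul, signedPerm_s hk, Equiv.Perm.mul_apply,
      Equiv.Perm.mul_apply]
    have h1 := flip_cases (k + 1) p
    have h2 := ih (by omega) (flip (k + 1) p)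
    have h3 := flip_cases (k + 1) (signedPerm m (tElt m k) (flip (k + 1) p))
    push_cast at *
    omega

theorem signedPerm_cosetRep_apply {m j : ℕ} (hj : j ≤ m) :
    signedPerm (m + 1) (cosetRep m j) m = m - j ∧
      signedPerm (m + 1) (cosetRep m j) (-m - 1) = j - m - 1 := by
  induction j with
  | zero => simp [cosetRep]
  | succ j ih =>
    obtain ⟨h1, h2⟩ := ih (by omega)
    rw [cosetRep_succ, map_mul, signedPerm_s (by omega), Equiv.Perm.mul_apply,
      Equiv.Perm.mul_apply, h1, h2]
    have h3 := flip_cases (m - j) (m - j)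
    have h4 := flip_cases (m - j) (j - m - 1)
    push_cast [Nat.cast_sub (by omega : j ≤ m)] at *
    omega

theorem signedPerm_injective (m : ℕ) : Function.Injective (signedPerm m) := by
  induction m with
  | zero =>
    have h : ∀ w : WB 0, w = 1 := by
      intro w
      induction w using WB.induction_left with
      | one => rfl
      | mul i hi w ih => omega
    exact fun a b _ => (h a).trans (h b).symm
  | succ m ih =>
    rw [injective_iff_map_eq_one]
    intro w hw
    have hm : signedPerm (m + 1) w m = m := by rw [hw]; rfl
    have hfix (h : WB m) : signedPerm m h m = m := signedPerm_apply_of_ge h (Or.inl le_rfl)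
    obtain ⟨j, hj, h, rfl | rfl⟩ := exists_eq_cosetRep_mul w
    · rw [map_mul, Equiv.Perm.mul_apply, signedPerm_incl, hfix,
        (signedPerm_cosetRep_apply hj).1] at hm
      obtain rfl : j = 0 := by omega
      rw [cosetRep, one_mul, signedPerm_incl] at hw
      rw [(injective_iff_map_eq_one _).1 ih h hw, cosetRep, map_one, one_mul]
    · have ht := signedPerm_tElt_cases (m := m + 1) (k := m) (by omega) m
      rw [map_mul, map_mul, Equiv.Perm.mul_apply, Equiv.Perm.mul_apply, signedPerm_incl, hfix,
        show signedPerm (m + 1) (tElt (m + 1) m) m = -m - 1 by omega,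
        (signedPerm_cosetRep_apply hj).2] at hm
      omega

/-! ### The second factor -/

/-- The generators `s_{m₁} ⋯ s₁ s₀ s₁ ⋯ s_{m₁}, s_{m₁+1}, s_{m₁+2}, …` of the second factor. -/
def shiftGen (m₁ m₂ : ℕ) : ℕ → WB (m₁ + m₂)
  | 0 => tElt (m₁ + m₂) m₁
  | j + 1 => s (m₁ + m₂) (j + 1 + m₁)

theorem typeBSystem_shiftGen (m₁ m₂ : ℕ) : TypeBSystem m₂ (shiftGen m₁ m₂) := by
  refine ⟨?_, ?_, ?_, ?_⟩
  · rintro (_ | i) hi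
    · exact tElt_mul_tElt (by omega)
    · exact s_mul_s (by omega)
  · rintro (_ | i) (_ | j) hij hj
    · omega
    · exact (commute_tElt_of_gt (by omega) (by omega)).symm
    · omega
    · exact commute_s (by omega) (by omega)
  · rintro (_ | i) h1 hi
    · omega
    · have h := (typeBSystem_s (m₁ + m₂)).braid (i + 1 + m₁) (by omega) (by omega)
      rwa [show i + 1 + m₁ + 1 = i + 1 + 1 + m₁ by omega] at h
  · intro h1
    have h := (commute_tElt_succ (m := m₁ + m₂) (k := m₁) (by omega)).eq
    simp only [shiftGen, zero_add, Nat.add_comm 1 m₁]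
    rw [tElt_succ] at h
    simpa only [mul_assoc] using h

/-- The homomorphism `W^B_{m₂} → W^B_{m₁+m₂}` onto the second factor. -/
def shift (m₁ m₂ : ℕ) : WB m₂ →* WB (m₁ + m₂) := (typeBSystem_shiftGen m₁ m₂).lift

theorem shift_s {m₁ m₂ j : ℕ} (hj : j < m₂) : shift m₁ m₂ (s m₂ j) = shiftGen m₁ m₂ j :=
  TypeBSystem.lift_s _ hj

theorem commute_incl_shift {m₁ m₂ : ℕ} (a : WB m₁) (b : WB m₂) :
    Commute (incl (m₁.le_add_right m₂) a) (shift m₁ m₂ b) := by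
  induction b using WB.induction_left with
  | one => rw [map_one]; exact Commute.one_right _
  | mul j hj b ih =>
    rw [map_mul, shift_s hj]
    refine Commute.mul_right ?_ ih
    cases j with
    | zero => exact commute_incl_tElt _ le_rfl (by omega) a
    | succ j =>
      clear ih
      induction a using WB.induction_left with
      | one => rw [map_one]; exact Commute.one_left _
      | mul i hi a ih =>
        rw [map_mul, incl_s _ hi]
        exact (commute_s (by omega) (by omega)).mul_left ih

theorem signedPerm_shift_apply {m₁ m₂ : ℕ} (b : WB m₂) {p : ℤ} (h1 : p < m₁) (h2 : -m₁ ≤ p) :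
    signedPerm (m₁ + m₂) (shift m₁ m₂ b) p = p := by
  induction b using WB.induction_left with
  | one => simp
  | mul j hj b ih =>
    rw [map_mul, map_mul, shift_s hj, Equiv.Perm.mul_apply, ih]
    cases j with
    | zero =>
      have := signedPerm_tElt_cases (m := m₁ + m₂) (k := m₁) (by omega) p
      simp only [shiftGen]
      omega
    | succ j =>
      have := flip_cases (j + 1 + m₁) p
      rw [shiftGen, signedPerm_s (by omega)]
      push_cast at *
      omega

/-- The signed relabelling that moves every point away from the centre by `n`. -/
def expand (n : ℕ) (p : ℤ) : ℤ := if 0 ≤ p then p + n else p - n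

theorem expand_cases (n : ℕ) (p : ℤ) :
    (0 ≤ p ∧ expand n p = p + n) ∨ (p < 0 ∧ expand n p = p - n) := by
  unfold expand
  split_ifs <;> omega

theorem signedPerm_shift_expand {m₁ m₂ : ℕ} (b : WB m₂) (p : ℤ) :
    signedPerm (m₁ + m₂) (shift m₁ m₂ b) (expand m₁ p) = expand m₁ (signedPerm m₂ b p) := by
  induction b using WB.induction_left with
  | one => simp
  | mul j hj b ih =>
    rw [map_mul, map_mul, shift_s hj, Equiv.Perm.mul_apply, ih, map_mul, signedPerm_s hj,
      Equiv.Perm.mul_apply]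
    generalize signedPerm m₂ b p = q
    have h1 := expand_cases m₁ q
    have h2 := flip_cases j q
    have h3 := expand_cases m₁ (flip j q)
    cases j with
    | zero =>
      have := signedPerm_tElt_cases (m := m₁ + m₂) (k := m₁) (by omega) (expand m₁ q)
      simp only [shiftGen]
      push_cast at *
      omega
    | succ j =>
      have := flip_cases (j + 1 + m₁) (expand m₁ q)
      rw [shiftGen, signedPerm_s (by omega)]
      push_cast at *
      omega

theorem shift_injective (m₁ m₂ : ℕ) : Function.Injective (shift m₁ m₂) := by
  rw [injective_iff_map_eq_one]
  intro b hb
  refine (injective_iff_map_eq_one _).1 (signedPerm_injective m₂) b (Equiv.ext fun p => ?_)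
  have h := signedPerm_shift_expand (m₁ := m₁) b p
  rw [hb, map_one, Equiv.Perm.one_apply] at h
  have h1 := expand_cases m₁ p
  have h2 := expand_cases m₁ (signedPerm m₂ b p)
  rw [Equiv.Perm.one_apply]
  omega

/-- The homomorphism `W^B_{m₁} × W^B_{m₂} → W^B_{m₁+m₂}` with image `Q`. -/
def prodHom (m₁ m₂ : ℕ) : WB m₁ × WB m₂ →* WB (m₁ + m₂) :=
  (incl (m₁.le_add_right m₂)).noncommCoprod (shift m₁ m₂) commute_incl_shift

theorem prodHom_apply {m₁ m₂ : ℕ} (a : WB m₁) (b : WB m₂) :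
    prodHom m₁ m₂ (a, b) = incl (m₁.le_add_right m₂) a * shift m₁ m₂ b := rfl

theorem prodHom_injective (m₁ m₂ : ℕ) : Function.Injective (prodHom m₁ m₂) := by
  rw [injective_iff_map_eq_one]
  rintro ⟨a, b⟩ h
  rw [prodHom_apply] at h
  have ha : a = 1 := by
    refine (injective_iff_map_eq_one _).1 (signedPerm_injective m₁) a (Equiv.ext fun p => ?_)
    by_cases hp : (m₁ : ℤ) ≤ p ∨ p < -m₁
    · exact signedPerm_apply_of_ge a hp
    · have hq := congrArg (fun w => signedPerm (m₁ + m₂) w p) h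
      simpa [signedPerm_incl, signedPerm_shift_apply b (by omega : p < m₁) (by omega)] using hq
  subst ha
  rw [map_one, one_mul] at h
  rw [(injective_iff_map_eq_one _).1 (shift_injective m₁ m₂) b h, Prod.mk_one_one]

theorem incl_mem_Q {m₁ m₂ : ℕ} (a : WB m₁) : incl (m₁.le_add_right m₂) a ∈ Q m₁ m₂ := by
  induction a using WB.induction_left with
  | one => rw [map_one]; exact one_mem _
  | mul i hi a ih =>
    rw [map_mul, incl_s _ hi]
    exact mul_mem (Subgroup.subset_closure (Or.inl (Or.inl ⟨i, hi, rfl⟩))) ih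

theorem shift_mem_Q {m₁ m₂ : ℕ} (b : WB m₂) : shift m₁ m₂ b ∈ Q m₁ m₂ := by
  induction b using WB.induction_left with
  | one => rw [map_one]; exact one_mem _
  | mul j hj b ih =>
    rw [map_mul, shift_s hj]
    refine mul_mem (Subgroup.subset_closure ?_) ih
    cases j with
    | zero => exact Or.inl (Or.inr rfl)
    | succ j => exact Or.inr ⟨j + 1 + m₁, by omega, by omega, rfl⟩

/-- Lemma 2.2.  For `m = m₁ + m₂` with `m₁, m₂ ≥ 1` there is a group
isomorphism `W^B_{m₁} × W^B_{m₂} ≅ Q` sending `(s_i, 1) ↦ s_i` for `0 ≤ i ≤ m₁ - 1`,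
`(1, s_j) ↦ s_{j+m₁}` for `1 ≤ j ≤ m₂ - 1`, and `(1, s₀) ↦ s_{m₁} ⋯ s₁ s₀ s₁ ⋯ s_{m₁}`. -/
theorem wb_prod_iso_quasiParabolic (m₁ m₂ : ℕ) (h₁ : 1 ≤ m₁) (h₂ : 1 ≤ m₂) :
    ∃ φ : WB m₁ × WB m₂ →* WB (m₁ + m₂),
      Function.Injective φ ∧ φ.range = Q m₁ m₂ ∧
      (∀ i : ℕ, i < m₁ → φ (s m₁ i, 1) = s (m₁ + m₂) i) ∧
      (∀ j : ℕ, 1 ≤ j → j < m₂ → φ (1, s m₂ j) = s (m₁ + m₂) (j + m₁)) ∧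
      φ (1, s m₂ 0) = tElt (m₁ + m₂) m₁ := by
  have hs : ∀ i : ℕ, i < m₁ → prodHom m₁ m₂ (s m₁ i, 1) = s (m₁ + m₂) i := fun i hi => by
    rw [prodHom_apply, map_one, mul_one, incl_s _ hi]
  have hs' : ∀ j : ℕ, 1 ≤ j → j < m₂ →
      prodHom m₁ m₂ (1, s m₂ j) = s (m₁ + m₂) (j + m₁) := by
    rintro (_ | j) hj hj'
    · omega
    · rw [prodHom_apply, map_one, one_mul, shift_s hj', shiftGen]
  have ht : prodHom m₁ m₂ (1, s m₂ 0) = tElt (m₁ + m₂) m₁ := by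
    rw [prodHom_apply, map_one, one_mul, shift_s h₂, shiftGen]
  refine ⟨prodHom m₁ m₂, prodHom_injective m₁ m₂, le_antisymm ?_ ?_, hs, hs', ht⟩
  · rintro _ ⟨⟨a, b⟩, rfl⟩
    exact mul_mem (incl_mem_Q a) (shift_mem_Q b)
  · refine (Subgroup.closure_le _).2 ?_
    rintro _ ((⟨i, hi, rfl⟩ | rfl) | ⟨j, h1, h2, rfl⟩)
    · exact ⟨_, hs i hi⟩
    · exact ⟨_, ht⟩
    · refine ⟨(1, s m₂ (j - m₁)), ?_⟩
      rw [hs' _ (by omega) (by omega), Nat.sub_add_cancel (by omega)]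

end VVPaper
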